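/- Let Y have the standard Pareto(1) distribution and let U be uniformly distributed on (0,1), independent of Y. Set X = U·e^Y. Then for all x > 0 and y > 0: t·P(X ≤ e^t·x, Y > t·y) → max(1/y − 1, 0) as t → ∞. In particular the limit does not depend on x, so the conditional non-degeneracy condition fails under the normalization α(t) = e^t for X. -/

import Mathlib

open MeasureTheory ProbabilityTheory Filter Set

/-- The mass a standard Pareto(1) variable gives to a half-open interval. -/
lemma pareto_measureReal_Ioc {Ω : Type*} [MeasurableSpace Ω] {P : Measure Ω} [IsFiniteMeasure P]
    {Y : Ω → ℝ} (hY : Measurable Y)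
    (hPareto : ∀ y : ℝ, 1 ≤ y → P {ω | y < Y ω} = ENNReal.ofReal (1 / y))
    {a b : ℝ} (ha : 1 ≤ a) (hb : 1 ≤ b) :
    P.real {ω | a < Y ω ∧ Y ω ≤ b} = max (1 / a - 1 / b) 0 := by
  have tail : ∀ c : ℝ, 1 ≤ c → P.real {ω | c < Y ω} = 1 / c := fun c hc => by
    rw [measureReal_def, hPareto c hc, ENNReal.toReal_ofReal (by positivity)]
  rcases le_total a b with hab | hab
  · have hdiff : {ω | a < Y ω ∧ Y ω ≤ b} = {ω | a < Y ω} \ {ω | b < Y ω} := by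
      ext ω; simp
    have hsub : {ω | b < Y ω} ⊆ {ω | a < Y ω} := fun ω h => lt_of_le_of_lt hab h
    rw [hdiff, measureReal_sdiff hsub (measurableSet_lt measurable_const hY), tail a ha, tail b hb,
      max_eq_left]
    exact sub_nonneg.2 (one_div_le_one_div_of_le (by positivity) hab)
  · have hempty : {ω | a < Y ω ∧ Y ω ≤ b} = ∅ := by
      ext ω; simp only [mem_ofPred_eq, mem_empty_iff_false, iff_false, not_and, not_le]
      exact fun h => lt_of_le_of_lt hab h
    rw [hempty, measureReal_empty, max_eq_right]
    exact sub_nonpos.2 (one_div_le_one_div_of_le (by positivity) hab)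

lemma uniform_measureReal_Iic_le {Ω : Type*} [MeasurableSpace Ω] {P : Measure Ω}
    {U : Ω → ℝ} (hU : Measurable U)
    (hUnif : P.map U = volume.restrict (Set.Ioo (0:ℝ) 1)) {c : ℝ} (hc : 0 ≤ c) :
    P.real {ω | U ω ≤ c} ≤ c := by
  have hle : P {ω | U ω ≤ c} ≤ ENNReal.ofReal c := by
    calc P {ω | U ω ≤ c} = P.map U (Iic c) := (Measure.map_apply hU measurableSet_Iic).symm
      _ = volume (Iic c ∩ Ioo 0 1) := by rw [hUnif, Measure.restrict_apply measurableSet_Iic]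
      _ ≤ volume (Ioc 0 c) := measure_mono fun u hu => ⟨hu.2.1, hu.1⟩
      _ = ENNReal.ofReal c := by rw [Real.volume_Ioc, sub_zero]
  exact ENNReal.toReal_le_of_le_ofReal hc hle

/-- Rescaled Pareto masses of intervals from `t * y` to `t + o(t)`. -/
lemma tendsto_max_sub_div_add {h : ℝ → ℝ} (hh : Tendsto (fun t => h t / t) atTop (nhds 0))
    (y : ℝ) :
    Tendsto (fun t : ℝ => max (1 / y - t / (t + h t)) 0) atTop (nhds (max (1 / y - 1) 0)) := by
  have hratio : Tendsto (fun t : ℝ => t / (t + h t)) atTop (nhds 1) := by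
    have hinv : Tendsto (fun t : ℝ => (1 + h t / t)⁻¹) atTop (nhds 1) := by
      simpa using (hh.const_add 1).inv₀ (by norm_num)
    refine hinv.congr' ?_
    filter_upwards [eventually_gt_atTop 0] with t ht
    rw [← inv_div (t + h t) t, add_div, div_self ht.ne']
  exact (hratio.const_sub (1 / y)).max tendsto_const_nhds

lemma mul_max_one_div_sub {t y b : ℝ} (ht : 0 < t) :
    t * max (1 / (t * y) - 1 / b) 0 = max (1 / y - t / b) 0 := by
  rw [mul_max_of_nonneg _ _ ht.le, mul_zero, mul_sub, mul_one_div, mul_one_div,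
    ← div_div, div_self ht.ne']

/-- For `X = U·e^Y` with `Y` standard Pareto(1) and `U`
uniform(0,1) independent of `Y`, the normalization `α(t) = e^t` yields a
limit degenerate in `x` (Example `excevmgen`). -/
theorem stmt13 {Ω : Type*} [MeasurableSpace Ω] (P : Measure Ω) [IsProbabilityMeasure P]
    (Y U : Ω → ℝ) (hY : Measurable Y) (hU : Measurable U)
    (hPareto : ∀ y : ℝ, 1 ≤ y → P {ω | y < Y ω} = ENNReal.ofReal (1 / y))
    (hPareto1 : P {ω | 1 ≤ Y ω} = 1)
    (hUnif : P.map U = volume.restrict (Set.Ioo (0:ℝ) 1))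
    (hIndep : IndepFun U Y P) :
    ∀ x y : ℝ, 0 < x → 0 < y →
      Tendsto (fun t : ℝ =>
          t * (P {ω | U ω * Real.exp (Y ω) ≤ Real.exp t * x ∧ t * y < Y ω}).toReal)
        atTop (nhds (max (1 / y - 1) 0)) := by
  intro x y hx hy
  have hlog : Tendsto (fun t : ℝ => 2 * Real.log t / t) atTop (nhds 0) := by
    have h := (Real.isLittleO_log_id_atTop.tendsto_div_nhds_zero).const_mul 2
    simpa [mul_div_assoc] using h
  have hlower := tendsto_max_sub_div_add (h := fun _ => Real.log x)
    (tendsto_const_nhds.div_atTop tendsto_id) y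
  have hupper := (tendsto_max_sub_div_add hlog y).add
    ((tendsto_const_nhds (x := x)).div_atTop tendsto_id)
  rw [add_zero] at hupper
  have hlt_one : ∀ᵐ ω ∂P, U ω < 1 := by
    have h : ∀ᵐ u ∂(P.map U), u < 1 := by
      rw [hUnif]
      filter_upwards [ae_restrict_mem measurableSet_Ioo] with u hu using hu.2
    exact ae_of_ae_map hU.aemeasurable h
  refine tendsto_of_tendsto_of_tendsto_of_le_of_le' hlower hupper ?_ ?_
  · filter_upwards [eventually_ge_atTop 1, eventually_ge_atTop (1 / y),
      eventually_ge_atTop (1 - Real.log x)] with t ht hty htx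
    have ht0 : 0 < t := by linarith
    rw [← mul_max_one_div_sub ht0,
      ← pareto_measureReal_Ioc hY hPareto ((div_le_iff₀ hy).1 hty) (by linarith)]
    refine mul_le_mul_of_nonneg_left
      (ENNReal.toReal_mono (measure_ne_top _ _) (measure_mono_ae ?_)) ht0.le
    filter_upwards [hlt_one] with ω hω h
    refine ⟨?_, h.1⟩
    calc U ω * Real.exp (Y ω) ≤ 1 * Real.exp (Y ω) := by gcongr
      _ ≤ Real.exp (t + Real.log x) := by rw [one_mul]; exact Real.exp_le_exp.2 h.2
      _ = Real.exp t * x := by rw [Real.exp_add, Real.exp_log hx]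
  · filter_upwards [eventually_ge_atTop 1, eventually_ge_atTop (1 / y)] with t ht hty
    have ht0 : 0 < t := by linarith
    have hlt : 0 ≤ Real.log t := Real.log_nonneg ht
    have hsub : {ω | U ω * Real.exp (Y ω) ≤ Real.exp t * x ∧ t * y < Y ω} ⊆
        {ω | t * y < Y ω ∧ Y ω ≤ t + 2 * Real.log t} ∪ {ω | U ω ≤ x / t ^ 2} := by
      rintro ω ⟨hω, hyω⟩
      rcases le_or_gt (Y ω) (t + 2 * Real.log t) with h | h
      · exact Or.inl ⟨hyω, h⟩
      · refine Or.inr ?_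
        have hexp : Real.exp t * t ^ 2 ≤ Real.exp (Y ω) := by
          calc Real.exp t * t ^ 2 = Real.exp (t + 2 * Real.log t) := by
                rw [Real.exp_add, two_mul, Real.exp_add, Real.exp_log ht0, sq]
            _ ≤ Real.exp (Y ω) := Real.exp_le_exp.2 h.le
        rw [mem_ofPred_eq, le_div_iff₀ (by positivity)]
        rcases le_or_gt (U ω) 0 with hneg | hpos
        · exact (mul_nonpos_of_nonpos_of_nonneg hneg (by positivity)).trans hx.le
        · refine le_of_mul_le_mul_left ?_ (Real.exp_pos t)
          calc Real.exp t * (U ω * t ^ 2) = U ω * (Real.exp t * t ^ 2) := by ring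
            _ ≤ U ω * Real.exp (Y ω) := by gcongr
            _ ≤ Real.exp t * x := hω
    have hmass : P.real {ω | U ω * Real.exp (Y ω) ≤ Real.exp t * x ∧ t * y < Y ω} ≤
        max (1 / (t * y) - 1 / (t + 2 * Real.log t)) 0 + x / t ^ 2 := by
      rw [← pareto_measureReal_Ioc hY hPareto ((div_le_iff₀ hy).1 hty)
        (by linarith : 1 ≤ t + 2 * Real.log t)]
      exact (measureReal_mono hsub).trans ((measureReal_union_le _ _).trans
        (by gcongr; exact uniform_measureReal_Iic_le hU hUnif (by positivity)))
    calc _ ≤ t * (max (1 / (t * y) - 1 / (t + 2 * Real.log t)) 0 + x / t ^ 2) :=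
          mul_le_mul_of_nonneg_left hmass ht0.le
      _ = max (1 / y - t / (t + 2 * Real.log t)) 0 + x / t := by
          rw [mul_add, mul_max_one_div_sub ht0]
          congr 1
          field_simp
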